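/- arXiv:2605.29121 — 9 statements merged into one kernel-verified Lean document; each statement's English description precedes it below -/
import Mathlib

section
/- Let a, γ, T > 0 and b1, b2 ∈ ℝ. If r1, r2 : ℝ → ℝ are differentiable and satisfy r_i'(t) = a·p_i(r1(t), r2(t)) - γ·r_i(t) + b_i for i = 1, 2, where p_i are the two-expert softmax probabilities with temperature T, then y = r1 - r2 is differentiable and satisfies y'(t) = a·tanh(y(t)/(2T)) - γ·y(t) + h with h = b1 - b2. -/
/-- The difference of the two softmax weights is the hyperbolic tangent of half the gap. -/
theorem softmax_sub_softmax_eq_tanh (u v : ℝ) :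
    Real.exp u / (Real.exp u + Real.exp v) - Real.exp v / (Real.exp u + Real.exp v)
      = Real.tanh ((u - v) / 2) := by
  have hu : Real.exp u = Real.exp ((u + v) / 2) * Real.exp ((u - v) / 2) := by
    rw [← Real.exp_add]; congr 1; ring
  have hv : Real.exp v = Real.exp ((u + v) / 2) * Real.exp (-((u - v) / 2)) := by
    rw [← Real.exp_add]; congr 1; ring
  rw [← sub_div, hu, hv, ← mul_sub, ← mul_add, mul_div_mul_left _ _ (Real.exp_ne_zero _),
    Real.tanh_eq_sinh_div_cosh, Real.sinh_eq, Real.cosh_eq,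
    div_div_div_cancel_right₀ two_ne_zero]

/-- If `r₁, r₂` solve the two-expert mean-field router ODE
`rᵢ' = a·pᵢ(r₁,r₂) - γ·rᵢ + bᵢ` with softmax probabilities at temperature `T`,
then `y = r₁ - r₂` solves `y' = a·tanh(y/(2T)) - γ·y + h` with `h = b₁ - b₂`. -/
theorem score_difference_dynamics
    (a γ T b1 b2 : ℝ) (ha : 0 < a) (hγ : 0 < γ) (hT : 0 < T)
    (r1 r2 : ℝ → ℝ)
    (h1 : ∀ t, HasDerivAt r1
      (a * (Real.exp (r1 t / T) / (Real.exp (r1 t / T) + Real.exp (r2 t / T)))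
        - γ * r1 t + b1) t)
    (h2 : ∀ t, HasDerivAt r2
      (a * (Real.exp (r2 t / T) / (Real.exp (r1 t / T) + Real.exp (r2 t / T)))
        - γ * r2 t + b2) t) :
    ∀ t, HasDerivAt (fun s => r1 s - r2 s)
      (a * Real.tanh ((r1 t - r2 t) / (2 * T)) - γ * (r1 t - r2 t) + (b1 - b2)) t := by
  intro t
  refine ((h1 t).fun_sub (h2 t)).congr_deriv ?_
  have hgap : (r1 t - r2 t) / (2 * T) = (r1 t / T - r2 t / T) / 2 := by
    rw [← sub_div, div_div, mul_comm T 2]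
  rw [hgap, ← softmax_sub_softmax_eq_tanh]
  ring
end

section
/- Let N ≥ 1, a, γ, T > 0, and let G : ℝ^N → ℝ^N be the vector field G_i(r) = a·p_i(r) - γ·r_i, where p is the N-expert softmax with temperature T. In the symmetric case the point r* with r*_i = a/(Nγ) for all i is an equilibrium (G(r*) = 0), and the Jacobian matrix J of G at r* satisfies: J·v = -γ·v for v proportional to (1,...,1), and J·v = (a/(NT) - γ)·v for every v ∈ ℝ^N with Σ_i v_i = 0. -/
open Finset in
/-- The derivative of the router component `a * pᵢ(s) - γ * sᵢ` at `r` along `v`, where `p` is the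
softmax with temperature `T`. -/
theorem fderiv_const_mul_softmax_sub_apply {ι : Type*} [Fintype ι] (a γ T : ℝ) (r v : ι → ℝ) (i : ι) :
    fderiv ℝ (fun s : ι → ℝ =>
        a * (Real.exp (s i / T) / ∑ k, Real.exp (s k / T)) - γ * s i) r v =
      a * (((Real.exp (r i / T) * (v i / T)) * ∑ k, Real.exp (r k / T) -
        Real.exp (r i / T) * ∑ k, Real.exp (r k / T) * (v k / T)) /
          (∑ k, Real.exp (r k / T)) ^ 2) - γ * v i := by
  have hpos : 0 < ∑ k, Real.exp (r k / T) :=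
    sum_pos (fun k _ => Real.exp_pos _) ⟨i, mem_univ i⟩
  have hdiff : DifferentiableAt ℝ (fun s : ι → ℝ =>
      a * (Real.exp (s i / T) / ∑ k, Real.exp (s k / T)) - γ * s i) r := by
    fun_prop (disch := exact hpos.ne')
  have hcoord (k : ι) : HasDerivAt (fun t : ℝ => (r + t • v) k) (v k) 0 := by
    simpa using ((hasDerivAt_id (0 : ℝ)).mul_const (v k)).const_add (r k)
  have hexp (k : ι) : HasDerivAt (fun t : ℝ => Real.exp ((r + t • v) k / T))
      (Real.exp (r k / T) * (v k / T)) 0 := by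
    simpa using ((hcoord k).div_const T).exp
  have hsum : HasDerivAt (fun t : ℝ => ∑ k, Real.exp ((r + t • v) k / T))
      (∑ k, Real.exp (r k / T) * (v k / T)) 0 :=
    HasDerivAt.fun_sum fun k _ => hexp k
  have hline := (((hexp i).fun_div hsum (by simpa using hpos.ne')).const_mul a).fun_sub
    ((hcoord i).const_mul γ)
  rw [← hdiff.lineDeriv_eq_fderiv]
  simpa [lineDeriv] using hline.deriv

/-- A matrix whose rows are the coordinates of the functionals `L i` acts on vectors as `L`. -/
theorem mulVec_apply_eq_of_apply_single {m n : Type*} [Fintype n] [DecidableEq n]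
    (A : Matrix m n ℝ) (L : m → (n → ℝ) →L[ℝ] ℝ) (hA : ∀ i j, A i j = L i (Pi.single j 1))
    (v : n → ℝ) (i : m) : A.mulVec v i = L i v := by
  conv_rhs => rw [pi_eq_sum_univ' v, map_sum]
  simp only [Matrix.mulVec, dotProduct, hA, map_smul, smul_eq_mul, mul_comm]

/-- For the `N`-expert mean-field router `G i r = a·pᵢ(r) - γ·rᵢ` (softmax at
temperature `T`), the symmetric point `r* = (a/(Nγ),…,a/(Nγ))` is an equilibrium,
and the Jacobian there has eigenvalue `-γ` on the diagonal `(1,…,1)` direction and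
eigenvalue `a/(NT) - γ` on the zero-sum contrast subspace. -/
theorem symmetric_equilibrium_and_jacobian_eigenvalues
    (N : ℕ) (hN : 1 ≤ N) (a γ T : ℝ) (ha : 0 < a) (hγ : 0 < γ) (hT : 0 < T)
    (G : (Fin N → ℝ) → Fin N → ℝ)
    (hG : ∀ s i, G s i = a * (Real.exp (s i / T) / ∑ k, Real.exp (s k / T)) - γ * s i)
    (rstar : Fin N → ℝ) (hrstar : ∀ i, rstar i = a / (N * γ))
    (J : Matrix (Fin N) (Fin N) ℝ)
    (hJ : ∀ i j, J i j = fderiv ℝ (fun s => G s i) rstar (Pi.single j 1)) :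
    G rstar = 0 ∧
    (∀ c : ℝ, J.mulVec (fun _ => c) = (-γ) • (fun _ => c : Fin N → ℝ)) ∧
    (∀ v : Fin N → ℝ, (∑ i, v i) = 0 → J.mulVec v = (a / (N * T) - γ) • v) := by
  have hNpos : (0 : ℝ) < N := by exact_mod_cast hN
  have hJv (v : Fin N → ℝ) (i : Fin N) :
      J.mulVec v i = a * (v i / (N * T) - (∑ k, v k) / (N ^ 2 * T)) - γ * v i := by
    rw [mulVec_apply_eq_of_apply_single J (fun i => fderiv ℝ (fun s => G s i) rstar) hJ]
    simp only [hG]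
    rw [fderiv_const_mul_softmax_sub_apply]
    simp only [hrstar, Finset.sum_const, Finset.card_univ, Fintype.card_fin, nsmul_eq_mul,
      ← Finset.mul_sum, ← Finset.sum_div]
    have hexp := Real.exp_pos (a / (N * γ) / T)
    field_simp
  refine ⟨?_, fun c => ?_, fun v hv => ?_⟩
  · ext i
    have hexp := Real.exp_pos (a / (N * γ) / T)
    simp only [hG, hrstar, Finset.sum_const, Finset.card_univ, Fintype.card_fin, nsmul_eq_mul,
      Pi.zero_apply]
    field_simp
    ring
  · ext i
    simp only [hJv, Finset.sum_const, Finset.card_univ, Fintype.card_fin, nsmul_eq_mul,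
      Pi.smul_apply, smul_eq_mul]
    field_simp
    ring
  · ext i
    simp only [hJv, hv, Pi.smul_apply, smul_eq_mul]
    ring
end

section
/- Let a, γ, T > 0 with a < 2γT, and let F0(y) = a·tanh(y/(2T)) - γ·y. Then y = 0 is the unique zero of F0, and y·F0(y) < 0 for all y ≠ 0 (so the equilibrium y = 0 of ẏ = F0(y) is globally asymptotically stable). -/
theorem Real.sinh_le_self_mul_cosh {x : ℝ} (hx : 0 ≤ x) :
    Real.sinh x ≤ x * Real.cosh x := by
  have hderiv (t : ℝ) :
      HasDerivAt (fun t : ℝ => t * Real.cosh t - Real.sinh t) (t * Real.sinh t) t := by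
    refine (((hasDerivAt_id' t).mul (Real.hasDerivAt_cosh t)).sub
      (Real.hasDerivAt_sinh t)).congr_deriv ?_
    ring
  have hmono : MonotoneOn (fun t : ℝ => t * Real.cosh t - Real.sinh t) (Set.Ici 0) := by
    refine monotoneOn_of_deriv_nonneg (convex_Ici 0) (by fun_prop)
      (fun t _ => (hderiv t).differentiableAt.differentiableWithinAt) fun t ht => ?_
    rw [(hderiv t).deriv]
    have ht' : 0 ≤ t := interior_subset ht
    exact mul_nonneg ht' (Real.sinh_nonneg_iff.2 ht')
  have h := hmono Set.self_mem_Ici hx hx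
  simp only [zero_mul, Real.sinh_zero, sub_zero] at h
  exact sub_nonneg.1 h

theorem Real.tanh_le_self {x : ℝ} (hx : 0 ≤ x) : Real.tanh x ≤ x := by
  rw [Real.tanh_eq_sinh_div_cosh, div_le_iff₀ (Real.cosh_pos x)]
  exact Real.sinh_le_self_mul_cosh hx

theorem Real.mul_tanh_le_sq (x : ℝ) : x * Real.tanh x ≤ x ^ 2 := by
  rw [sq]
  rcases le_total 0 x with hx | hx
  · exact mul_le_mul_of_nonneg_left (Real.tanh_le_self hx) hx
  · refine mul_le_mul_of_nonpos_left ?_ hx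
    have h := Real.tanh_le_self (neg_nonneg.2 hx)
    rw [Real.tanh_neg] at h
    exact neg_le_neg_iff.1 h


/-- Below the pitchfork threshold (`a < 2γT`), `y = 0` is the unique zero of
`F₀(y) = a·tanh(y/(2T)) - γ·y` and `y·F₀(y) < 0` for `y ≠ 0`. -/
theorem subcritical_unique_stable_equilibrium
    (a γ T : ℝ) (ha : 0 < a) (hγ : 0 < γ) (hT : 0 < T) (hlt : a < 2 * γ * T)
    (F0 : ℝ → ℝ) (hF0 : ∀ y, F0 y = a * Real.tanh (y / (2 * T)) - γ * y) :
    (∀ y : ℝ, F0 y = 0 ↔ y = 0) ∧ (∀ y : ℝ, y ≠ 0 → y * F0 y < 0) := by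
  have hneg : ∀ y : ℝ, y ≠ 0 → y * F0 y < 0 := by
    intro y hy
    obtain ⟨x, rfl⟩ : ∃ x, y = 2 * T * x := ⟨y / (2 * T), by field_simp⟩
    have hx : 0 < x ^ 2 := by
      have := right_ne_zero_of_mul hy
      positivity
    rw [hF0, mul_div_cancel_left₀ x (by positivity)]
    calc 2 * T * x * (a * Real.tanh x - γ * (2 * T * x))
        = 2 * T * (a * (x * Real.tanh x) - 2 * γ * T * x ^ 2) := by ring
      _ ≤ 2 * T * (a * x ^ 2 - 2 * γ * T * x ^ 2) := by
        gcongr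
        exact Real.mul_tanh_le_sq x
      _ < 0 := mul_neg_of_pos_of_neg (by positivity)
        (sub_neg.2 (mul_lt_mul_of_pos_right hlt hx))
  refine ⟨fun y => ⟨fun h => ?_, fun h => by simp [h, hF0]⟩, hneg⟩
  by_contra hy
  simpa [h] using hneg y hy
end

section
/- Let a, γ, T > 0 with a = 2γT, and let F0(y) = a·tanh(y/(2T)) - γ·y. Then y = 0 is the unique zero of F0, y·F0(y) < 0 for all y ≠ 0, and F0'(0) = 0 (so the equilibrium y = 0 is asymptotically stable but nonhyperbolic). -/
theorem Real.sinh_lt_self_mul_cosh {x : ℝ} (hx : 0 < x) : Real.sinh x < x * Real.cosh x := by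
  have hderiv (y : ℝ) : HasDerivAt (fun z => z * Real.cosh z - Real.sinh z) (y * Real.sinh y) y := by
    refine (((hasDerivAt_id' y).mul (Real.hasDerivAt_cosh y)).sub
      (Real.hasDerivAt_sinh y)).congr_deriv ?_
    ring
  have hmono : StrictMonoOn (fun z => z * Real.cosh z - Real.sinh z) (Set.Ici 0) := by
    refine strictMonoOn_of_deriv_pos (convex_Ici 0)
      (fun y _ => (hderiv y).continuousAt.continuousWithinAt) fun y hy => ?_
    rw [interior_Ici, Set.mem_Ioi] at hy
    rw [(hderiv y).deriv]
    exact mul_pos hy (Real.sinh_pos_iff.2 hy)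
  simpa using hmono Set.self_mem_Ici hx.le hx

theorem Real.tanh_lt_self {x : ℝ} (hx : 0 < x) : Real.tanh x < x := by
  rw [Real.tanh_eq_sinh_div_cosh, div_lt_iff₀ (Real.cosh_pos x)]
  exact Real.sinh_lt_self_mul_cosh hx

theorem Real.mul_tanh_sub_self_neg {x : ℝ} (hx : x ≠ 0) : x * (Real.tanh x - x) < 0 := by
  rcases hx.lt_or_gt with h | h
  · have := Real.tanh_lt_self (neg_pos.2 h)
    rw [Real.tanh_neg] at this
    exact mul_neg_of_neg_of_pos h (by linarith)
  · exact mul_neg_of_pos_of_neg h (sub_neg.2 (Real.tanh_lt_self h))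

theorem Real.hasDerivAt_tanh_zero : HasDerivAt Real.tanh 1 0 := by
  have h := (Real.hasDerivAt_sinh 0).fun_div (Real.hasDerivAt_cosh 0) (Real.cosh_pos 0).ne'
  simpa [← Real.tanh_eq_sinh_div_cosh] using h

/-- At the pitchfork threshold (`a = 2γT`), `y = 0` is the unique zero of
`F₀(y) = a·tanh(y/(2T)) - γ·y`, `y·F₀(y) < 0` for `y ≠ 0`, and `F₀'(0) = 0`:
the equilibrium is asymptotically stable but nonhyperbolic. -/
theorem critical_stable_nonhyperbolic_equilibrium
    (a γ T : ℝ) (ha : 0 < a) (hγ : 0 < γ) (hT : 0 < T) (heq : a = 2 * γ * T)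
    (F0 : ℝ → ℝ) (hF0 : ∀ y, F0 y = a * Real.tanh (y / (2 * T)) - γ * y) :
    (∀ y : ℝ, F0 y = 0 ↔ y = 0) ∧ (∀ y : ℝ, y ≠ 0 → y * F0 y < 0) ∧
      deriv F0 0 = 0 := by
  have hneg (y : ℝ) (hy : y ≠ 0) : y * F0 y < 0 := by
    have hx : y / (2 * T) ≠ 0 := div_ne_zero hy (by positivity)
    have hfactor : y * F0 y =
        4 * γ * T ^ 2 * (y / (2 * T) * (Real.tanh (y / (2 * T)) - y / (2 * T))) := by
      rw [hF0, heq]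
      field_simp
      ring
    rw [hfactor]
    exact mul_neg_of_pos_of_neg (by positivity) (Real.mul_tanh_sub_self_neg hx)
  refine ⟨fun y => ⟨fun h => ?_, fun h => by simp [hF0, h]⟩, hneg, ?_⟩
  · by_contra hy
    simpa [h] using hneg y hy
  · have hinner : HasDerivAt (fun y : ℝ => y / (2 * T)) (1 / (2 * T)) 0 :=
      (hasDerivAt_id' 0).div_const _
    have htanh : HasDerivAt Real.tanh 1 ((0 : ℝ) / (2 * T)) := by
      simpa using Real.hasDerivAt_tanh_zero
    have hF : HasDerivAt F0 (a * (1 * (1 / (2 * T))) - γ * 1) 0 := by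
      rw [funext hF0]
      exact ((htanh.comp 0 hinner).const_mul a).sub ((hasDerivAt_id' 0).const_mul γ)
    rw [hF.deriv, heq]
    field_simp
    ring
end

section
/- Let a, γ, T > 0 with a > 2γT, define q_a = arcosh(√(a/(2γT))) and H(a) = 2γT·(sinh(q_a)·cosh(q_a) - q_a). If |h| < H(a), then F(y) = a·tanh(y/(2T)) - γ·y + h has exactly three real zeros y1 < y2 < y3. -/
open Set in
/-- A continuous function that strictly decreases, increases, and decreases again, and whose
values change sign on each of the three pieces, has exactly three zeros. -/
theorem exists_three_zeros_of_antitone_monotone_antitone {G : ℝ → ℝ} (hG : Continuous G)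
    {u p q v : ℝ} (hup : u < p) (hpq : p < q) (hqv : q < v)
    (h_left : StrictAntiOn G (Iic p)) (h_mid : StrictMonoOn G (Icc p q))
    (h_right : StrictAntiOn G (Ici q))
    (hu : 0 < G u) (hp : G p < 0) (hq : 0 < G q) (hv : G v < 0) :
    ∃ x y z : ℝ, x < y ∧ y < z ∧ ∀ t, G t = 0 ↔ t = x ∨ t = y ∨ t = z := by
  obtain ⟨x, hx, hGx⟩ := intermediate_value_Ioo' hup.le hG.continuousOn ⟨hp, hu⟩
  obtain ⟨y, hy, hGy⟩ := intermediate_value_Ioo hpq.le hG.continuousOn ⟨hp, hq⟩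
  obtain ⟨z, hz, hGz⟩ := intermediate_value_Ioo' hqv.le hG.continuousOn ⟨hv, hq⟩
  refine ⟨x, y, z, hx.2.trans hy.1, hy.2.trans hz.1, fun t ↦ ⟨fun ht ↦ ?_, ?_⟩⟩
  · rcases le_total t p with htp | hpt
    · exact Or.inl (h_left.injOn htp hx.2.le (ht.trans hGx.symm))
    rcases le_total t q with htq | hqt
    · exact Or.inr (Or.inl (h_mid.injOn ⟨hpt, htq⟩ ⟨hy.1.le, hy.2.le⟩ (ht.trans hGy.symm)))
    · exact Or.inr (Or.inr (h_right.injOn hqt hz.1.le (ht.trans hGz.symm)))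
  · rintro (rfl | rfl | rfl) <;> assumption

theorem Real.hasDerivAt_tanh_inv_cosh_sq (x : ℝ) :
    HasDerivAt Real.tanh (1 / Real.cosh x ^ 2) x := by
  have h := (Real.hasDerivAt_sinh x).div (Real.hasDerivAt_cosh x) (Real.cosh_pos x).ne'
  have h_eq : Real.tanh = Real.sinh / Real.cosh := funext Real.tanh_eq_sinh_div_cosh
  rwa [← sq, ← sq, Real.cosh_sq_sub_sinh_sq, ← h_eq] at h

/-- The scaled field `q ↦ c cosh² r tanh q - c q + h`, with critical points `± r`, has exactly
three zeros as soon as its two critical values have opposite signs. -/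
theorem exists_three_zeros_tanh_sub_linear {c r h : ℝ} (hc : 0 < c) (hr : 0 < r)
    (hh : |h| < c * (Real.sinh r * Real.cosh r - r)) :
    ∃ x y z : ℝ, x < y ∧ y < z ∧ ∀ t : ℝ,
      c * Real.cosh r ^ 2 * Real.tanh t - c * t + h = 0 ↔ t = x ∨ t = y ∨ t = z := by
  obtain ⟨h_lower, h_upper⟩ := abs_lt.mp hh
  set G : ℝ → ℝ := fun t ↦ c * Real.cosh r ^ 2 * Real.tanh t - c * t + h
  have hr_cosh := Real.cosh_pos r
  have h_deriv (t : ℝ) : HasDerivAt G (c * Real.cosh r ^ 2 * (1 / Real.cosh t ^ 2) - c * 1) t :=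
    (((Real.hasDerivAt_tanh_inv_cosh_sq t).const_mul _).sub
      ((hasDerivAt_id t).const_mul c)).add_const h
  have h_cont : Continuous G :=
    continuous_iff_continuousAt.mpr fun t ↦ (h_deriv t).continuousAt
  have h_deriv_eq (t : ℝ) :
      deriv G t = c * (Real.cosh r ^ 2 - Real.cosh t ^ 2) / Real.cosh t ^ 2 := by
    rw [(h_deriv t).deriv]
    have := (Real.cosh_pos t).ne'
    field_simp
  have h_neg {t : ℝ} (ht : r < |t|) : deriv G t < 0 := by
    have h_lt : Real.cosh r < Real.cosh t :=
      Real.cosh_lt_cosh.mpr (by rwa [abs_of_pos hr])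
    rw [h_deriv_eq]
    refine div_neg_of_neg_of_pos (mul_neg_of_pos_of_neg hc ?_) (by positivity)
    nlinarith
  have h_pos {t : ℝ} (ht : |t| < r) : 0 < deriv G t := by
    have h_lt : Real.cosh t < Real.cosh r :=
      Real.cosh_lt_cosh.mpr (by rwa [abs_of_pos hr])
    have := Real.cosh_pos t
    rw [h_deriv_eq]
    refine div_pos (mul_pos hc ?_) (by positivity)
    nlinarith
  have h_val : c * Real.cosh r ^ 2 * Real.tanh r = c * (Real.sinh r * Real.cosh r) := by
    rw [Real.tanh_eq_sinh_div_cosh]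
    field_simp
  set d := Real.cosh r ^ 2 + |h| / c with hd
  have hd_pos : 0 < d := by positivity
  have hd_mul : c * d = c * Real.cosh r ^ 2 + |h| := by
    rw [hd]
    field_simp
  have h_coeff : 0 < c * Real.cosh r ^ 2 := by positivity
  refine exists_three_zeros_of_antitone_monotone_antitone h_cont (u := -r - d) (p := -r)
    (q := r) (v := r + d) (by linarith) (by linarith) (by linarith) ?_ ?_ ?_ ?_ ?_ ?_ ?_
  · refine strictAntiOn_of_deriv_neg (convex_Iic _) h_cont.continuousOn fun t ht ↦ h_neg ?_
    rw [interior_Iic] at ht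
    exact lt_abs.mpr (Or.inr (lt_neg.mpr ht))
  · refine strictMonoOn_of_deriv_pos (convex_Icc _ _) h_cont.continuousOn fun t ht ↦ h_pos ?_
    rw [interior_Icc] at ht
    exact abs_lt.mpr ht
  · refine strictAntiOn_of_deriv_neg (convex_Ici _) h_cont.continuousOn fun t ht ↦ h_neg ?_
    rw [interior_Ici] at ht
    exact lt_abs.mpr (Or.inl ht)
  · have h_tanh := mul_lt_mul_of_pos_left (Real.neg_one_lt_tanh (-r - d)) h_coeff
    nlinarith [neg_abs_le h, mul_pos hc hr]
  · simp only [Real.tanh_neg]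
    linarith
  · linarith
  · have h_tanh := mul_lt_mul_of_pos_left (Real.tanh_lt_one (r + d)) h_coeff
    nlinarith [le_abs_self h, mul_pos hc hr]

/-- Inside the cusp region: for `a > 2γT` and `|h| < H(a)` with
`H(a) = 2γT·(sinh q_a · cosh q_a - q_a)`, `q_a = arcosh √(a/(2γT))`, the function
`F(y) = a·tanh(y/(2T)) - γ·y + h` has exactly three real zeros `y₁ < y₂ < y₃`. -/
theorem three_equilibria_inside_fold_region
    (a γ T h : ℝ) (ha : 0 < a) (hγ : 0 < γ) (hT : 0 < T) (hgt : 2 * γ * T < a)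
    (qa : ℝ) (hqa0 : 0 ≤ qa) (hqa : Real.cosh qa = Real.sqrt (a / (2 * γ * T)))
    (H : ℝ) (hH : H = 2 * γ * T * (Real.sinh qa * Real.cosh qa - qa))
    (hh : |h| < H) :
    ∃ y1 y2 y3 : ℝ, y1 < y2 ∧ y2 < y3 ∧
      (∀ y : ℝ, a * Real.tanh (y / (2 * T)) - γ * y + h = 0 ↔
        (y = y1 ∨ y = y2 ∨ y = y3)) := by
  have hc : 0 < 2 * γ * T := by positivity
  have hqa_pos : 0 < qa := by
    refine hqa0.lt_of_ne ?_
    rintro rfl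
    have h_nonneg := abs_nonneg h
    simp only [Real.sinh_zero, zero_mul, sub_zero, mul_zero] at hH
    linarith
  have ha_eq : 2 * γ * T * Real.cosh qa ^ 2 = a := by
    rw [hqa, Real.sq_sqrt (by positivity)]
    field_simp
  obtain ⟨x, y, z, hxy, hyz, h_zeros⟩ :=
    exists_three_zeros_tanh_sub_linear hc hqa_pos (hH ▸ hh)
  have hT2 : 0 < 2 * T := by positivity
  refine ⟨x * (2 * T), y * (2 * T), z * (2 * T), by gcongr, by gcongr, fun t ↦ ?_⟩
  have h_scaled := h_zeros (t / (2 * T))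
  have h_lin : 2 * γ * T * (t / (2 * T)) = γ * t := by field_simp
  rwa [ha_eq, h_lin, div_eq_iff hT2.ne', div_eq_iff hT2.ne', div_eq_iff hT2.ne'] at h_scaled
end

section
/- Let a, γ, T > 0 with a > 2γT, define q_a = arcosh(√(a/(2γT))) and H(a) = 2γT·(sinh(q_a)·cosh(q_a) - q_a). If |h| > H(a), then F(y) = a·tanh(y/(2T)) - γ·y + h has exactly one real zero. -/
theorem Real.hasDerivAt_mul_tanh_sub_id (b x : ℝ) :
    HasDerivAt (fun q => b * Real.tanh q - q) (b / Real.cosh x ^ 2 - 1) x := by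
  have hc : Real.cosh x ≠ 0 := (Real.cosh_pos x).ne'
  have ht : HasDerivAt Real.tanh (1 / Real.cosh x ^ 2) x := by
    have hd := (Real.hasDerivAt_sinh x).div (Real.hasDerivAt_cosh x) hc
    have he : Real.tanh = Real.sinh / Real.cosh := by
      funext q
      exact Real.tanh_eq_sinh_div_cosh q
    rw [he]
    refine hd.congr_deriv ?_
    rw [← sq, ← sq, Real.cosh_sq_sub_sinh_sq]
  exact ((ht.const_mul b).sub (hasDerivAt_id x)).congr_deriv (by ring)

theorem Real.continuous_mul_tanh_sub_id (b : ℝ) : Continuous fun q => b * Real.tanh q - q :=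
  continuous_iff_continuousAt.2 fun x => (Real.hasDerivAt_mul_tanh_sub_id b x).continuousAt

/-- The graph of `q ↦ cosh² p · tanh q - q` falls strictly to the right of `p`. -/
theorem Real.strictAntiOn_mul_tanh_sub_id {p : ℝ} (hp : 0 ≤ p) :
    StrictAntiOn (fun q => Real.cosh p ^ 2 * Real.tanh q - q) (Set.Ici p) := by
  refine strictAntiOn_of_deriv_neg (convex_Ici p)
    (Real.continuous_mul_tanh_sub_id _).continuousOn fun x hx => ?_
  rw [interior_Ici, Set.mem_Ioi] at hx
  rw [(Real.hasDerivAt_mul_tanh_sub_id _ x).deriv, sub_neg,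
    div_lt_one (pow_pos (Real.cosh_pos x) 2)]
  gcongr
  rw [Real.cosh_lt_cosh, abs_of_nonneg hp, abs_of_nonneg (hp.trans hx.le)]
  exact hx

theorem Real.monotoneOn_mul_tanh_sub_id {p : ℝ} (hp : 0 ≤ p) :
    MonotoneOn (fun q => Real.cosh p ^ 2 * Real.tanh q - q) (Set.Icc (-p) p) := by
  refine monotoneOn_of_deriv_nonneg (convex_Icc _ _)
    (Real.continuous_mul_tanh_sub_id _).continuousOn
    (fun x _ => (Real.hasDerivAt_mul_tanh_sub_id _ x).differentiableAt.differentiableWithinAt)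
    fun x hx => ?_
  have hx' := interior_subset hx
  rw [(Real.hasDerivAt_mul_tanh_sub_id _ x).deriv, sub_nonneg,
    one_le_div (pow_pos (Real.cosh_pos x) 2)]
  gcongr
  rw [Real.cosh_le_cosh, abs_of_nonneg hp]
  exact abs_le.2 hx'

/-- To the left of `p`, the minimum of `q ↦ cosh² p · tanh q - q` is attained at `-p`. -/
theorem Real.neg_le_mul_tanh_sub_id {p q : ℝ} (hp : 0 ≤ p) (hq : q ≤ p) :
    -(Real.sinh p * Real.cosh p - p) ≤ Real.cosh p ^ 2 * Real.tanh q - q := by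
  have hc : Real.cosh p ≠ 0 := (Real.cosh_pos p).ne'
  have hv : Real.cosh p ^ 2 * Real.tanh p = Real.sinh p * Real.cosh p := by
    rw [Real.tanh_eq_sinh_div_cosh]
    field_simp
  rcases le_total (-p) q with h | h
  · have hm := Real.monotoneOn_mul_tanh_sub_id hp ⟨le_rfl, by linarith⟩ ⟨h, hq⟩ h
    simp only [Real.tanh_neg] at hm
    linarith
  · have hm := (Real.strictAntiOn_mul_tanh_sub_id hp).antitoneOn (Set.mem_Ici.2 le_rfl)
      (Set.mem_Ici.2 (le_neg_of_le_neg h)) (le_neg_of_le_neg h)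
    simp only [Real.tanh_neg] at hm
    linarith

theorem Real.existsUnique_mul_tanh_sub_id_add_eq_zero {p k : ℝ} (hp : 0 ≤ p)
    (hk : Real.sinh p * Real.cosh p - p < k) :
    ∃! q : ℝ, Real.cosh p ^ 2 * Real.tanh q - q + k = 0 := by
  have hpos : ∀ q ≤ p, 0 < Real.cosh p ^ 2 * Real.tanh q - q + k := fun q hq => by
    linarith [Real.neg_le_mul_tanh_sub_id hp hq]
  set M := max p (Real.cosh p ^ 2 + k)
  have hneg : Real.cosh p ^ 2 * Real.tanh M - M + k ≤ 0 := by
    nlinarith [Real.tanh_lt_one M, pow_pos (Real.cosh_pos p) 2,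
      le_max_right p (Real.cosh p ^ 2 + k)]
  obtain ⟨q, -, hq⟩ := intermediate_value_Icc' (le_max_left p (Real.cosh p ^ 2 + k))
    ((Real.continuous_mul_tanh_sub_id (Real.cosh p ^ 2)).add_const k).continuousOn
    ⟨hneg, (hpos p le_rfl).le⟩
  have hge : ∀ r, Real.cosh p ^ 2 * Real.tanh r - r + k = 0 → r ∈ Set.Ici p := fun r hr => by
    by_contra hlt
    exact (hpos r (not_le.1 hlt).le).ne' hr
  refine ⟨q, hq, fun r hr => ?_⟩
  refine (Real.strictAntiOn_mul_tanh_sub_id hp).injOn (hge r hr) (hge q hq) ?_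
  exact add_right_cancel (hr.trans hq.symm)

theorem Real.existsUnique_mul_tanh_sub_id_add_eq_zero_of_lt_abs {p k : ℝ} (hp : 0 ≤ p)
    (hk : Real.sinh p * Real.cosh p - p < |k|) :
    ∃! q : ℝ, Real.cosh p ^ 2 * Real.tanh q - q + k = 0 := by
  rcases lt_abs.1 hk with h | h
  · exact Real.existsUnique_mul_tanh_sub_id_add_eq_zero hp h
  · obtain ⟨q, hq, hu⟩ := Real.existsUnique_mul_tanh_sub_id_add_eq_zero hp h
    refine ⟨-q, ?_, fun r hr => ?_⟩
    · simp only [Real.tanh_neg]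
      linarith
    · rw [← hu (-r) (by simp only [Real.tanh_neg]; linarith), neg_neg]

/-- Outside the cusp region: for `a > 2γT` and `|h| > H(a)` with
`H(a) = 2γT·(sinh q_a · cosh q_a - q_a)`, `q_a = arcosh √(a/(2γT))`, the function
`F(y) = a·tanh(y/(2T)) - γ·y + h` has exactly one real zero. -/
theorem unique_equilibrium_outside_fold_region
    (a γ T h : ℝ) (ha : 0 < a) (hγ : 0 < γ) (hT : 0 < T) (hgt : 2 * γ * T < a)
    (qa : ℝ) (hqa0 : 0 ≤ qa) (hqa : Real.cosh qa = Real.sqrt (a / (2 * γ * T)))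
    (H : ℝ) (hH : H = 2 * γ * T * (Real.sinh qa * Real.cosh qa - qa))
    (hh : H < |h|) :
    ∃! y : ℝ, a * Real.tanh (y / (2 * T)) - γ * y + h = 0 := by
  have hc : 0 < 2 * γ * T := by positivity
  have hC : Real.cosh qa ^ 2 = a / (2 * γ * T) := by
    rw [hqa, Real.sq_sqrt (by positivity)]
  have hk : Real.sinh qa * Real.cosh qa - qa < |h / (2 * γ * T)| := by
    rw [abs_div, abs_of_pos hc, lt_div_iff₀ hc]
    linarith
  have hF : ∀ y : ℝ, a * Real.tanh (y / (2 * T)) - γ * y + h = 2 * γ * T *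
      (Real.cosh qa ^ 2 * Real.tanh (y / (2 * T)) - y / (2 * T) + h / (2 * γ * T)) := fun y => by
    rw [hC]
    field_simp
  simp only [hF, mul_eq_zero, hc.ne', false_or]
  obtain ⟨q, hq, hu⟩ := Real.existsUnique_mul_tanh_sub_id_add_eq_zero_of_lt_abs hqa0 hk
  refine ⟨q * (2 * T), ?_, fun y hy => ?_⟩
  · simpa only [mul_div_cancel_right₀ q (by positivity : 2 * T ≠ 0)] using hq
  · exact (div_eq_iff (by positivity)).1 (hu _ hy)
end

section
/- Let a, γ, T > 0 and h ∈ ℝ, and suppose F(y) = a·tanh(y/(2T)) - γ·y + h has exactly three real zeros y1 < y2 < y3. Then F'(y1) < 0, F'(y2) > 0, and F'(y3) < 0; that is, the outer equilibria of ẏ = F(y) are stable and the middle one is unstable. -/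
theorem hasDerivAt_tanh_sub_linear (a γ T h y : ℝ) :
    HasDerivAt (fun y => a * Real.tanh (y / (2 * T)) - γ * y + h)
      (a * (1 / Real.cosh (y / (2 * T)) ^ 2 * (1 / (2 * T))) - γ) y := by
  have h1 : HasDerivAt (fun y : ℝ => y / (2 * T)) (1 / (2 * T)) y :=
    (hasDerivAt_id y).div_const _
  have h2 := ((Real.hasDerivAt_tanh_inv_cosh_sq (y / (2 * T))).comp y h1).const_mul a
  simpa using (h2.sub ((hasDerivAt_id y).const_mul γ)).add_const h

/-- Alternating stability: if `F(y) = a·tanh(y/(2T)) - γ·y + h` has exactly three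
zeros `y₁ < y₂ < y₃`, then the outer equilibria are stable (`F' < 0`) and the
middle one is unstable (`F' > 0`). -/
theorem three_equilibria_alternating_stability
    (a γ T h : ℝ) (ha : 0 < a) (hγ : 0 < γ) (hT : 0 < T)
    (F : ℝ → ℝ) (hF : ∀ y, F y = a * Real.tanh (y / (2 * T)) - γ * y + h)
    (y1 y2 y3 : ℝ) (h12 : y1 < y2) (h23 : y2 < y3)
    (hz : ∀ y : ℝ, F y = 0 ↔ (y = y1 ∨ y = y2 ∨ y = y3)) :
    deriv F y1 < 0 ∧ 0 < deriv F y2 ∧ deriv F y3 < 0 := by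
  have hd : ∀ y, HasDerivAt F
      (a * (1 / Real.cosh (y / (2 * T)) ^ 2 * (1 / (2 * T))) - γ) y := by
    rw [funext hF]
    exact hasDerivAt_tanh_sub_linear a γ T h
  have anti : ∀ x y, |x| < |y| → deriv F y < deriv F x := by
    intro x y hxy
    rw [(hd x).deriv, (hd y).deriv]
    have hT2 : 0 < 2 * T := by positivity
    have hc : Real.cosh (x / (2 * T)) < Real.cosh (y / (2 * T)) := by
      rw [Real.cosh_lt_cosh, abs_div, abs_div]
      have : 0 < |2 * T| := abs_pos.mpr hT2.ne'
      gcongr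
    have hx := Real.cosh_pos (x / (2 * T))
    gcongr
  have hcont : Continuous F := continuous_iff_continuousAt.mpr fun y => (hd y).continuousAt
  have z1 : F y1 = 0 := (hz y1).mpr (by simp)
  have z2 : F y2 = 0 := (hz y2).mpr (by simp)
  have z3 : F y3 = 0 := (hz y3).mpr (by simp)
  obtain ⟨c, ⟨hc1, hc2⟩, hc⟩ := exists_deriv_eq_zero h12 hcont.continuousOn (z1.trans z2.symm)
  obtain ⟨d, ⟨hd1, hd2⟩, hd0⟩ := exists_deriv_eq_zero h23 hcont.continuousOn (z2.trans z3.symm)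
  have habs : |c| = |d| := by
    rcases lt_trichotomy |c| |d| with hlt | heq | hlt
    · linarith [anti _ _ hlt]
    · exact heq
    · linarith [anti _ _ hlt]
  have hcd : c = -d := (abs_eq_abs.mp habs).resolve_left (by linarith)
  have hdpos : 0 < d := by linarith
  refine ⟨?_, ?_, ?_⟩
  · rw [← hd0]
    exact anti _ _ (by rw [abs_of_pos hdpos]; exact lt_abs.mpr (.inr (by linarith)))
  · rw [← hd0]
    exact anti _ _ (by rw [abs_of_pos hdpos]; exact abs_lt.mpr ⟨by linarith, hd1⟩)
  · rw [← hd0]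
    exact anti _ _ (by rw [abs_of_pos hdpos]; exact lt_abs.mpr (.inl hd2))
end

section
/- Let a, γ, T > 0 with a ≤ 2γT. Then for every h ∈ ℝ, the function F(y) = a·tanh(y/(2T)) - γ·y + h has exactly one real zero (no multistability below the pitchfork threshold). -/
theorem Real.hasDerivAt_tanh (x : ℝ) :
    HasDerivAt Real.tanh (1 - Real.tanh x ^ 2) x := by
  have hc : Real.cosh x ≠ 0 := (Real.cosh_pos x).ne'
  have hfun : Real.tanh = Real.sinh / Real.cosh := funext Real.tanh_eq_sinh_div_cosh
  have hval : 1 - Real.tanh x ^ 2 =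
      (Real.cosh x * Real.cosh x - Real.sinh x * Real.sinh x) / Real.cosh x ^ 2 := by
    rw [Real.tanh_eq_sinh_div_cosh]
    field_simp
  rw [hval, hfun]
  exact (Real.hasDerivAt_sinh x).div (Real.hasDerivAt_cosh x) hc

theorem Real.differentiable_tanh : Differentiable ℝ Real.tanh := fun x ↦
  (Real.hasDerivAt_tanh x).differentiableAt

theorem Real.strictMono_sub_tanh : StrictMono fun x : ℝ ↦ x - Real.tanh x := by
  refine strictMono_of_odd_strictMonoOn_nonneg (fun x ↦ by rw [Real.tanh_neg]; ring) ?_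
  refine strictMonoOn_of_deriv_pos (convex_Ici 0)
    (continuous_id.sub Real.differentiable_tanh.continuous).continuousOn fun x hx ↦ ?_
  rw [interior_Ici, Set.mem_Ioi] at hx
  have hderiv : HasDerivAt (fun x ↦ x - Real.tanh x) (1 - (1 - Real.tanh x ^ 2)) x :=
    (hasDerivAt_id' x).sub (Real.hasDerivAt_tanh x)
  rw [hderiv.deriv, sub_sub_cancel, Real.tanh_eq_sinh_div_cosh]
  have := Real.sinh_pos_iff.2 hx
  have := Real.cosh_pos x
  positivity

/-- No multistability below the pitchfork threshold: if `a ≤ 2γT`, then for every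
skew `h` the function `F(y) = a·tanh(y/(2T)) - γ·y + h` has exactly one real zero. -/
theorem unique_equilibrium_below_threshold
    (a γ T : ℝ) (ha : 0 < a) (hγ : 0 < γ) (hT : 0 < T) (hle : a ≤ 2 * γ * T) :
    ∀ h : ℝ, ∃! y : ℝ, a * Real.tanh (y / (2 * T)) - γ * y + h = 0 := by
  intro h
  set F : ℝ → ℝ := fun y ↦ a * Real.tanh (y / (2 * T)) - γ * y + h with hF
  have hanti : StrictAnti F := by
    intro x y hxy
    have hdiv : x / (2 * T) < y / (2 * T) := by gcongr
    have hsub := mul_lt_mul_of_pos_left (Real.strictMono_sub_tanh hdiv) ha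
    have hlin : a * (y / (2 * T) - x / (2 * T)) ≤ γ * (y - x) := by
      calc a * (y / (2 * T) - x / (2 * T))
          ≤ 2 * γ * T * (y / (2 * T) - x / (2 * T)) :=
            mul_le_mul_of_nonneg_right hle (sub_pos.2 hdiv).le
        _ = γ * (y - x) := by field_simp
    simp only [hF]
    linarith
  have hcont : Continuous F := by
    have := Real.differentiable_tanh.continuous
    fun_prop
  have hneg : F ((a + h) / γ) ≤ 0 := by
    simp only [hF]
    rw [mul_div_cancel₀ _ hγ.ne']
    nlinarith [Real.tanh_lt_one ((a + h) / γ / (2 * T))]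
  have hpos : 0 ≤ F ((h - a) / γ) := by
    simp only [hF]
    rw [mul_div_cancel₀ _ hγ.ne']
    nlinarith [Real.neg_one_lt_tanh ((h - a) / γ / (2 * T))]
  obtain ⟨y, hy⟩ := mem_range_of_exists_le_of_exists_ge hcont ⟨_, hneg⟩ ⟨_, hpos⟩
  exact ⟨y, hy, fun z hz ↦ hanti.injective (hz.trans hy.symm)⟩
end

section
/- Let γ, T > 0 and for a > 2γT define q_a = arcosh(√(a/(2γT))) and H(a) = 2γT·(sinh(q_a)·cosh(q_a) - q_a). Then H(a) > 0 for every a > 2γT, H(a) → 0 as a → 2γT from above, and H is strictly increasing on (2γT, ∞); consequently the mean-field hysteresis width Δh(a) = 2H(a) is positive and strictly increasing in the feedback strength a. -/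
theorem strictMono_sinh_mul_cosh_sub_id :
    StrictMono fun x : ℝ => Real.sinh x * Real.cosh x - x := by
  intro x y hxy
  have h := Real.sinh_sub_id_strictMono (show 2 * x < 2 * y by linarith)
  simp only [Real.sinh_two_mul] at h
  dsimp only
  linarith

/-- Properties of the fold boundary `H(a) = 2γT·(sinh q_a · cosh q_a - q_a)` with
`q_a = arcosh √(a/(2γT))` (characterized by `q_a ≥ 0`, `cosh q_a = √(a/(2γT))`):
`H > 0` on `(2γT, ∞)`, `H(a) → 0` as `a → 2γT⁺`, and `H` is strictly increasing on
`(2γT, ∞)`; hence the hysteresis width `Δh = 2H` is positive and strictly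
increasing in `a`. -/
theorem hysteresis_width_properties
    (γ T : ℝ) (hγ : 0 < γ) (hT : 0 < T)
    (q : ℝ → ℝ) (hq0 : ∀ a, 2 * γ * T < a → 0 ≤ q a)
    (hqc : ∀ a, 2 * γ * T < a → Real.cosh (q a) = Real.sqrt (a / (2 * γ * T)))
    (H : ℝ → ℝ)
    (hH : ∀ a, H a = 2 * γ * T * (Real.sinh (q a) * Real.cosh (q a) - q a)) :
    (∀ a, 2 * γ * T < a → 0 < H a) ∧
    Filter.Tendsto H (nhdsWithin (2 * γ * T) (Set.Ioi (2 * γ * T))) (nhds 0) ∧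
    StrictMonoOn H (Set.Ioi (2 * γ * T)) ∧
    (∀ a, 2 * γ * T < a → 0 < 2 * H a) ∧
    StrictMonoOn (fun a => 2 * H a) (Set.Ioi (2 * γ * T)) := by
  set c := 2 * γ * T with hc
  have hcpos : 0 < c := by positivity
  have hone : ∀ a, c < a → 1 < a / c := fun a ha => (one_lt_div hcpos).2 ha
  have hq : ∀ a, c < a → q a = Real.arcosh √(a / c) := fun a ha => by
    rw [← hqc a ha, Real.arcosh_cosh (hq0 a ha)]
  have hqpos : ∀ a, c < a → 0 < q a := fun a ha => by
    rw [hq a ha]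
    exact Real.arcosh_pos (Real.lt_sqrt_of_sq_lt (by simpa using hone a ha))
  have hpos : ∀ a, c < a → 0 < H a := fun a ha => by
    have h := strictMono_sinh_mul_cosh_sub_id (hqpos a ha)
    simp only [Real.sinh_zero, zero_mul, sub_zero] at h
    rw [hH]
    exact mul_pos hcpos h
  have hqmono : ∀ a b, c < a → a < b → q a < q b := fun a b ha hab => by
    have hb := ha.trans hab
    have hcosh : Real.cosh (q a) < Real.cosh (q b) := by
      rw [hqc a ha, hqc b hb]
      exact Real.sqrt_lt_sqrt (by linarith [hone a ha]) (by gcongr)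
    rwa [Real.cosh_lt_cosh, abs_of_nonneg (hq0 a ha), abs_of_nonneg (hq0 b hb)] at hcosh
  have hmono : StrictMonoOn H (Set.Ioi c) := fun a ha b _ hab => by
    rw [hH, hH]
    exact mul_lt_mul_of_pos_left
      (strictMono_sinh_mul_cosh_sub_id (hqmono a b ha hab)) hcpos
  have hqlim : Filter.Tendsto q (nhdsWithin c (Set.Ioi c)) (nhds 0) := by
    have hsqrt : Filter.Tendsto (fun a => √(a / c)) (nhdsWithin c (Set.Ioi c))
        (nhdsWithin 1 (Set.Ici 1)) := by
      refine tendsto_nhdsWithin_iff.2 ⟨?_, ?_⟩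
      · have hcont : Continuous fun a : ℝ => √(a / c) := by fun_prop
        have h := hcont.tendsto c
        simp only [div_self hcpos.ne', Real.sqrt_one] at h
        exact h.mono_left nhdsWithin_le_nhds
      · filter_upwards [self_mem_nhdsWithin] with a ha
        exact Real.one_le_sqrt.2 (hone a ha).le
    have h := (Real.continuousOn_arcosh 1 Set.self_mem_Ici).tendsto.comp hsqrt
    rw [Real.arcosh_zero] at h
    refine h.congr' ?_
    filter_upwards [self_mem_nhdsWithin] with a ha
    exact (hq a ha).symm
  have hlim : Filter.Tendsto H (nhdsWithin c (Set.Ioi c)) (nhds 0) := by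
    have hcont : Continuous fun x : ℝ => c * (Real.sinh x * Real.cosh x - x) := by fun_prop
    have h := (hcont.tendsto 0).comp hqlim
    simp only [Real.sinh_zero, zero_mul, sub_zero, mul_zero] at h
    exact h.congr fun a => (hH a).symm
  exact ⟨hpos, hlim, hmono, fun a ha => mul_pos two_pos (hpos a ha),
    fun a ha b hb hab => mul_lt_mul_of_pos_left (hmono ha hb hab) two_pos⟩
end
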